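/- arXiv:2512.20801 — 2 statements merged into one kernel-verified Lean document; each statement's English description precedes it below -/
import Mathlib

section
/- Let D be a domain. For any nonzero x ∈ D, there is a unique prime ideal p_x of R(D) that is maximal among prime ideals not containing 1/x. -/
noncomputable def recip (D : Type*) [CommRing D] [IsDomain D] : Subring (FractionRing D) :=
  Subring.closure {x | ∃ d : D, d ≠ 0 ∧ x = (algebraMap D (FractionRing D) d)⁻¹}

namespace recip

variable {D : Type*} [CommRing D] [IsDomain D]

lemma inv_algebraMap_mem (d : D) : (algebraMap D (FractionRing D) d)⁻¹ ∈ recip D := by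
  by_cases hd : d = 0
  · simp [hd]
  · exact Subring.subset_closure ⟨d, hd, rfl⟩

/-- The map `d ↦ 1 / d` from `D` to its reciprocal complement (sending `0` to `0`). -/
noncomputable def inv : D →*₀ recip D where
  toFun d := ⟨(algebraMap D (FractionRing D) d)⁻¹, inv_algebraMap_mem d⟩
  map_zero' := Subtype.ext (by simp)
  map_one' := Subtype.ext (by simp)
  map_mul' a b := Subtype.ext (by simp only [Subring.coe_mul, map_mul, mul_inv])

@[simp]
lemma coe_inv (d : D) :
    (inv d : FractionRing D) = (algebraMap D (FractionRing D) d)⁻¹ := rfl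

/-- If every `1 / d` with `d ∉ U` lies in the ideal `J`, then every element of `R(D)` is congruent
modulo `J` to a fraction with denominator in `U`. -/
lemma exists_eq_div_add {U : Submonoid D} (hU : 0 ∉ U) {J : Ideal (recip D)}
    (hJ : ∀ d ∉ U, inv d ∈ J) (a : recip D) :
    ∃ m ∈ J, ∃ p, ∃ q ∈ U, (a : FractionRing D) =
      algebraMap D (FractionRing D) p / algebraMap D (FractionRing D) q + m := by
  have hne {q : D} (hq : q ∈ U) : algebraMap D (FractionRing D) q ≠ 0 := by
    simpa using ne_of_mem_of_not_mem hq hU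
  obtain ⟨a, ha⟩ := a
  unfold recip at ha
  induction ha using Subring.closure_induction with
  | mem a ha =>
    obtain ⟨d, -, rfl⟩ := ha
    by_cases hd : d ∈ U
    · exact ⟨0, J.zero_mem, 1, d, hd, by simp⟩
    · exact ⟨inv d, hJ d hd, 0, 1, U.one_mem, by simp⟩
  | zero => exact ⟨0, J.zero_mem, 0, 1, U.one_mem, by simp⟩
  | one => exact ⟨0, J.zero_mem, 1, 1, U.one_mem, by simp⟩
  | add a b ha hb iha ihb =>
    obtain ⟨m, hm, p, q, hq, h⟩ := iha
    obtain ⟨m', hm', p', q', hq', h'⟩ := ihb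
    refine ⟨m + m', J.add_mem hm hm', p * q' + q * p', q * q', U.mul_mem hq hq', ?_⟩
    simp only at h h'
    have := hne hq
    have := hne hq'
    simp only [h, h', map_add, map_mul, Subring.coe_add]
    field_simp
    ring
  | neg a ha iha =>
    obtain ⟨m, hm, p, q, hq, h⟩ := iha
    refine ⟨-m, J.neg_mem hm, -p, q, hq, ?_⟩
    simp only at h
    simp only [h, map_neg, Subring.coe_neg]
    ring
  | mul a b ha hb iha ihb =>
    obtain ⟨m, hm, p, q, hq, h⟩ := iha
    obtain ⟨m', hm', p', q', hq', h'⟩ := ihb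
    refine ⟨⟨a, ha⟩ * m' + (⟨b, hb⟩ - m') * m,
      J.add_mem (J.mul_mem_left _ hm') (J.mul_mem_left _ hm), p * p', q * q',
      U.mul_mem hq hq', ?_⟩
    simp only at h h'
    have := hne hq
    have := hne hq'
    simp only [h, h', map_mul, Subring.coe_add, Subring.coe_mul, AddSubgroupClass.coe_sub]
    field_simp
    ring

/-- The submonoid of those `d` for which `1 / d` avoids the prime ideal `P`. -/
noncomputable def avoiding (P : Ideal (recip D)) [P.IsPrime] : Submonoid D :=
  P.primeCompl.comap (inv : D →*₀ recip D)

lemma mem_avoiding {P : Ideal (recip D)} [P.IsPrime] {d : D} :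
    d ∈ avoiding P ↔ inv d ∉ P := Iff.rfl

lemma zero_notMem_avoiding (P : Ideal (recip D)) [P.IsPrime] : 0 ∉ avoiding P := by
  simp [mem_avoiding]

/-- A fraction whose denominator has reciprocal outside the prime `P` lies in `P` only if it is
zero. -/
lemma eq_zero_of_eq_div {P : Ideal (recip D)} [P.IsPrime] {b : recip D} (hb : b ∈ P) {p q : D}
    (hq : q ∈ avoiding P) (h : (b : FractionRing D) =
      algebraMap D (FractionRing D) p / algebraMap D (FractionRing D) q) : b = 0 := by
  by_cases hp : p = 0
  · ext; simp [h, hp]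
  · have hp' : algebraMap D (FractionRing D) p ≠ 0 := by simpa using hp
    refine absurd ?_ (mem_avoiding.1 hq)
    have : inv q = b * inv p := by
      ext
      simp only [coe_inv, Subring.coe_mul, h]
      field_simp
    exact this ▸ P.mul_mem_right _ hb

/-- Let `P` be maximal among the primes avoiding `1 / x`. If `1 / d ∉ P`, then `1 / d` divides a
power of `1 / x`. -/
lemma exists_inv_dvd_pow {x d : D} {P : Ideal (recip D)}
    (hP : Maximal (fun Q : Ideal (recip D) ↦ Q.IsPrime ∧ inv x ∉ Q) P) (hd : inv d ∉ P) :
    ∃ n, inv d ∣ inv x ^ n := by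
  have := hP.prop.1
  have hlt : ¬ Disjoint ((P ⊔ Ideal.span {inv d} : Ideal (recip D)) : Set (recip D))
      (Submonoid.powers (inv x)) := by
    intro hdisj
    obtain ⟨Q, hQ, hle, hQd⟩ := Ideal.exists_le_prime_disjoint _ _ hdisj
    have hQx : inv x ∉ Q := fun h ↦
      Set.disjoint_left.1 hQd h (Submonoid.mem_powers _)
    exact hd (hP.le_of_ge ⟨hQ, hQx⟩ (le_sup_left.trans hle)
      (hle (le_sup_right (a := P) (Ideal.mem_span_singleton_self _))))
  obtain ⟨_, hy, n, rfl⟩ := Set.not_disjoint_iff.1 hlt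
  obtain ⟨m, hm, y, hy, hsum⟩ := Submodule.mem_sup.1 hy
  simp only at hsum
  obtain ⟨c, rfl⟩ := Ideal.mem_span_singleton'.1 hy
  obtain ⟨m', hm', p, q, hq, hc⟩ := exists_eq_div_add (zero_notMem_avoiding P)
    (J := P) (fun e he ↦ by simpa [mem_avoiding] using he) c
  have hne {e : D} (he : e ∈ avoiding P) : algebraMap D (FractionRing D) e ≠ 0 := by
    simpa using ne_of_mem_of_not_mem he (zero_notMem_avoiding P)
  have hx : x ∈ avoiding P := hP.prop.2
  have h0 : m + m' * inv d = 0 := by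
    refine eq_zero_of_eq_div (P := P) (P.add_mem hm (P.mul_mem_right _ hm'))
      (p := q * d - x ^ n * p) (q := q * d * x ^ n)
      (mul_mem (mul_mem hq hd) (pow_mem hx n)) ?_
    have h1 := hne hq
    have h2 := hne (e := d) hd
    have h3 := hne hx
    have h4 : (m : FractionRing D) = (algebraMap D (FractionRing D) x)⁻¹ ^ n -
        c * (algebraMap D (FractionRing D) d)⁻¹ := by
      have := congrArg (Subtype.val) hsum
      simp only [Subring.coe_add, Subring.coe_mul, Subring.coe_pow, coe_inv] at this
      rw [← this]; ring
    simp only [Subring.coe_add, Subring.coe_mul, coe_inv, h4, hc, map_sub, map_mul, map_pow,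
      inv_pow]
    field_simp
    ring
  exact ⟨n, c - m', by rw [← hsum]; linear_combination h0⟩

/-- A prime maximal among those avoiding `1 / x` contains every other such prime. -/
lemma le_of_maximal {x : D} {P P' : Ideal (recip D)}
    (hP : Maximal (fun Q : Ideal (recip D) ↦ Q.IsPrime ∧ inv x ∉ Q) P)
    (hP' : Maximal (fun Q : Ideal (recip D) ↦ Q.IsPrime ∧ inv x ∉ Q) P') : P' ≤ P := by
  have := hP.prop.1
  have := hP'.prop.1
  have key {Q Q' : Ideal (recip D)}
      (hQ : Maximal (fun Q : Ideal (recip D) ↦ Q.IsPrime ∧ inv x ∉ Q) Q)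
      (hQ' : Q'.IsPrime ∧ inv x ∉ Q') {d : D} (hd : inv d ∉ Q) : inv d ∉ Q' := by
    intro h
    obtain ⟨n, hn⟩ := exists_inv_dvd_pow hQ hd
    exact hQ'.2 (hQ'.1.mem_of_pow_mem n (Q'.mem_of_dvd hn h))
  intro a ha
  obtain ⟨m, hm, p, q, hq, h⟩ := exists_eq_div_add (zero_notMem_avoiding P') (J := P ⊓ P')
    (fun e he ↦ by
      have he' : inv e ∈ P' := by simpa [mem_avoiding] using he
      exact ⟨by_contra fun h ↦ key hP hP'.prop h he', he'⟩) a
  have h0 : a - m = 0 := eq_zero_of_eq_div (P'.sub_mem ha hm.2) (p := p) hq (by simp [h])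
  exact sub_eq_zero.1 h0 ▸ hm.1

/-- Every prime avoiding `1 / x` lies in one that is maximal with this property. -/
lemma exists_le_maximal (x : D) {Q : Ideal (recip D)} (hQ : Q.IsPrime) (hx : inv x ∉ Q) :
    ∃ P, Q ≤ P ∧ Maximal (fun Q : Ideal (recip D) ↦ Q.IsPrime ∧ inv x ∉ Q) P := by
  refine zorn_le_nonempty₀ {Q : Ideal (recip D) | Q.IsPrime ∧ inv x ∉ Q} ?_ Q ⟨hQ, hx⟩
  intro c hc hchain I hI
  have hmem {y : recip D} : y ∈ sSup c ↔ ∃ J ∈ c, y ∈ J :=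
    Submodule.mem_sSup_of_directed ⟨I, hI⟩ hchain.directedOn
  refine ⟨sSup c, ⟨⟨?_, ?_⟩, ?_⟩, fun J hJ ↦ le_sSup hJ⟩
  · rw [Ideal.ne_top_iff_one, hmem]
    rintro ⟨J, hJ, h1⟩
    exact (hc hJ).2 (by simpa using J.mul_mem_left (inv x) h1)
  · intro a b hab
    obtain ⟨J, hJ, h⟩ := hmem.1 hab
    exact ((hc hJ).1.mem_or_mem h).imp (fun h ↦ hmem.2 ⟨J, hJ, h⟩) (fun h ↦ hmem.2 ⟨J, hJ, h⟩)
  · rw [hmem]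
    rintro ⟨J, hJ, h⟩
    exact (hc hJ).2 h

end recip

/-- For any nonzero `x ∈ D`, there is a unique prime ideal `p_x` of
`R(D)` maximal among the prime ideals not containing `1/x`. -/
theorem stmt_11 {D : Type*} [CommRing D] [IsDomain D] (x : D) (hx : x ≠ 0) :
    ∃! p : Ideal (recip D), p.IsPrime ∧
      (⟨(algebraMap D (FractionRing D) x)⁻¹,
        Subring.subset_closure ⟨x, hx, rfl⟩⟩ : recip D) ∉ p ∧
      ∀ q : Ideal (recip D), q.IsPrime →
        (⟨(algebraMap D (FractionRing D) x)⁻¹,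
          Subring.subset_closure ⟨x, hx, rfl⟩⟩ : recip D) ∉ q → q ≤ p := by
  change ∃! p : Ideal (recip D), p.IsPrime ∧ recip.inv x ∉ p ∧
    ∀ q : Ideal (recip D), q.IsPrime → recip.inv x ∉ q → q ≤ p
  have hbot : recip.inv x ∉ (⊥ : Ideal (recip D)) := by
    simpa [Subtype.ext_iff] using hx
  obtain ⟨P, -, hP⟩ := recip.exists_le_maximal x Ideal.isPrime_bot hbot
  refine ⟨P, ⟨hP.prop.1, hP.prop.2, fun q hq hxq ↦ ?_⟩, fun P' hP' ↦ ?_⟩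
  · obtain ⟨P', hle, hP'⟩ := recip.exists_le_maximal x hq hxq
    exact hle.trans (recip.le_of_maximal hP hP')
  · exact hP.eq_of_le ⟨hP'.1, hP'.2.1⟩ (hP'.2.2 P hP.prop.1 hP.prop.2) |>.symm
end

section
/- If R(D) is Noetherian for a domain D, then the Krull dimension of R(D) is at most 1. -/
/-- A form of Nakayama's lemma for ideals of a domain. -/
theorem Ideal.eq_bot_of_fg_of_le_mul {R : Type*} [CommRing R] [IsDomain R] {I P : Ideal R}
    (hI : I ≠ ⊤) (hP : P.FG) (hle : P ≤ I * P) : P = ⊥ := by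
  obtain ⟨r, hr, hrP⟩ :=
    Submodule.exists_sub_one_mem_and_smul_eq_zero_of_fg_of_le_smul I P hP hle
  by_contra hP0
  obtain ⟨x, hx, hx0⟩ := Submodule.exists_mem_ne_zero_of_ne_bot hP0
  have hr0 : r = 0 := (mul_eq_zero.1 (hrP x hx)).resolve_right hx0
  rw [hr0, zero_sub, neg_mem_iff] at hr
  exact hI ((Ideal.eq_top_iff_one _).2 hr)

section HeightOne

variable {R : Type*} [CommRing R] [IsDomain R] [IsNoetherianRing R]

/-- In a Noetherian domain, if some nonzero element lies in every nonzero prime contained in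
the prime `M`, then `M` has height at most one. -/
theorem height_le_one_of_mem_nonzero_primes_le (M : Ideal R) [M.IsPrime] (c : R) (hc : c ≠ 0)
    (h : ∀ P : Ideal R, P.IsPrime → P ≠ ⊥ → P ≤ M → c ∈ P) : M.height ≤ 1 := by
  obtain rfl | hM0 := eq_or_ne M ⊥
  · simp
  by_cases hM : ∃ Q ∈ (Ideal.span {c}).minimalPrimes, M ≤ Q
  · obtain ⟨Q, hQ, hMQ⟩ := hM
    exact (Ideal.height_mono hMQ).trans
      (Ideal.height_le_one_of_isPrincipal_of_mem_minimalPrimes _ Q hQ)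
  exfalso
  have hfin := Ideal.finite_minimalPrimes_of_isNoetherianRing R (Ideal.span {c})
  have hsub := mt (Ideal.subset_union_prime_finite hfin (f := fun I => I) ⊥ ⊥
    (fun i hi _ _ => hi.1.1) (I := M)).1 hM
  obtain ⟨x, hxM, hx⟩ := Set.not_subset.1 hsub
  simp only [Set.mem_iUnion, not_exists] at hx
  obtain ⟨Q, hQ, hQM⟩ := Ideal.exists_minimalPrimes_le (I := Ideal.span {x}) (J := M)
    ((Ideal.span_singleton_le_iff_mem _).2 hxM)
  have hQprime : Q.IsPrime := hQ.1.1
  have hxQ : x ∈ Q := (Ideal.span_singleton_le_iff_mem _).1 hQ.1.2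
  have hQ1 := Ideal.height_le_one_of_isPrincipal_of_mem_minimalPrimes _ Q hQ
  have hcQ : c ∈ Q := by
    refine h Q hQprime ?_ hQM
    rintro rfl
    obtain rfl : x = 0 := hxQ
    obtain ⟨Q₀, hQ₀, -⟩ := Ideal.exists_minimalPrimes_le (I := Ideal.span {c}) (J := M)
      ((Ideal.span_singleton_le_iff_mem _).2 (h M inferInstance hM0 le_rfl))
    exact hx Q₀ hQ₀ Q₀.zero_mem
  obtain ⟨Q₀, hQ₀, hQ₀Q⟩ := Ideal.exists_minimalPrimes_le (I := Ideal.span {c}) (J := Q)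
    ((Ideal.span_singleton_le_iff_mem _).2 hcQ)
  have hQ₀prime : Q₀.IsPrime := hQ₀.1.1
  have hlt : Q₀ < Q := lt_of_le_of_ne hQ₀Q (by rintro rfl; exact hx _ hQ₀ hxQ)
  have h1 := Ideal.height_add_one_le_of_lt_of_isPrime hlt
  have h0 : Q₀.height = 0 := by
    have h2 : Q₀.height + 1 ≤ 0 + 1 := by simpa using h1.trans hQ1
    exact le_bot_iff.1 ((ENat.add_le_add_iff_right ENat.one_ne_top).1 h2)
  rw [Ideal.height_eq_zero_iff_eq_bot] at h0
  exact hc (by simpa [h0] using (Ideal.span_singleton_le_iff_mem _).1 hQ₀.1.2)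

end HeightOne

section Recip

variable {D : Type*} [CommRing D] [IsDomain D]

/-- The reciprocal of `d` as an element of `recip D`, with value `0` at `d = 0`. -/
noncomputable def recipInv : D →*₀ recip D where
  toFun d := ⟨(algebraMap D (FractionRing D) d)⁻¹, by
    by_cases hd : d = 0
    · simp [hd, (recip D).zero_mem]
    · exact Subring.subset_closure ⟨d, hd, rfl⟩⟩
  map_zero' := by ext; simp
  map_one' := by ext; simp
  map_mul' a b := Subtype.ext (by
    simp only [Subring.coe_mul, map_mul, mul_inv])

theorem coe_recipInv (d : D) :
    (recipInv d : FractionRing D) = (algebraMap D (FractionRing D) d)⁻¹ := rfl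

theorem recipInv_ne_zero {d : D} (hd : d ≠ 0) : recipInv d ≠ 0 := by
  intro h
  have := congrArg (Subtype.val) h
  simp [coe_recipInv, hd] at this

theorem recipInv_neg (d : D) : recipInv (-d) = -recipInv d := by
  ext
  simp [coe_recipInv, inv_neg]

theorem recipInv_add_mul {a b : D} (ha : a ≠ 0) (hb : b ≠ 0) (hab : a + b ≠ 0) :
    recipInv (a + b) * (recipInv a + recipInv b) = recipInv (a * b) := by
  have ha' : algebraMap D (FractionRing D) a ≠ 0 := by simpa using ha
  have hb' : algebraMap D (FractionRing D) b ≠ 0 := by simpa using hb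
  have hab' : algebraMap D (FractionRing D) a + algebraMap D (FractionRing D) b ≠ 0 := by
    rw [← map_add]
    exact (map_ne_zero_iff _ (IsFractionRing.injective D (FractionRing D))).2 hab
  ext
  simp only [Subring.coe_mul, Subring.coe_add, coe_recipInv, map_add, map_mul]
  field_simp
  ring

theorem recip_induction {p : recip D → Prop} (inv : ∀ d : D, p (recipInv d))
    (add : ∀ x y, p x → p y → p (x + y)) (neg : ∀ x, p x → p (-x))
    (mul : ∀ x y, p x → p y → p (x * y)) (x : recip D) : p x := by
  obtain ⟨x, hx⟩ := x
  refine Subring.closure_induction (p := fun x hx => p ⟨x, hx⟩) ?_ ?_ ?_ ?_ ?_ ?_ hx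
  · rintro _ ⟨d, -, rfl⟩
    exact inv d
  · have := inv 0
    rwa [map_zero] at this
  · have := inv 1
    rwa [map_one] at this
  · exact fun x y hx hy h1 h2 => add ⟨x, hx⟩ ⟨y, hy⟩ h1 h2
  · exact fun x hx h1 => neg ⟨x, hx⟩ h1
  · exact fun x y hx hy h1 h2 => mul ⟨x, hx⟩ ⟨y, hy⟩ h1 h2

variable (P : Ideal (recip D))

/-- The elements of `D` whose reciprocal avoids the prime `P`, together with `0`. -/
noncomputable def avoidingSubring [hP : P.IsPrime] : Subring D where
  carrier := {d | d ≠ 0 → recipInv d ∉ P}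
  zero_mem' h := absurd rfl h
  one_mem' _ := by
    rw [map_one]
    exact fun h => hP.ne_top ((Ideal.eq_top_iff_one _).2 h)
  neg_mem' {d} hd h := by
    rw [recipInv_neg, neg_mem_iff]
    exact hd (by simpa using h)
  mul_mem' {a b} ha hb h := by
    rw [map_mul]
    exact fun hm => (hP.mem_or_mem hm).elim (ha (left_ne_zero_of_mul h))
      (hb (right_ne_zero_of_mul h))
  add_mem' {a b} ha hb h hm := by
    by_cases ha0 : a = 0
    · subst ha0
      rw [zero_add] at h hm
      exact hb h hm
    by_cases hb0 : b = 0
    · subst hb0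
      rw [add_zero] at h hm
      exact ha h hm
    have hmul := P.mul_mem_right (recipInv a + recipInv b) hm
    rw [recipInv_add_mul ha0 hb0 h, map_mul] at hmul
    exact (hP.mem_or_mem hmul).elim (ha ha0) (hb hb0)

/-- The subring of `recip D` generated by the reciprocals avoiding `P`. -/
noncomputable def avoidingRecip : Subring (recip D) :=
  Subring.closure {x | ∃ d : D, recipInv d ∉ P ∧ x = recipInv d}

/-- The reciprocals of nonzero elements lying in `P`. -/
def recipsIn : Set (recip D) := {x | x ∈ P ∧ ∃ d : D, d ≠ 0 ∧ x = recipInv d}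

theorem exists_fraction_of_mem_avoidingRecip [hP : P.IsPrime] {s : recip D}
    (hs : s ∈ avoidingRecip P) : ∃ a b : D, a ∈ avoidingSubring P ∧ b ∈ avoidingSubring P ∧
      b ≠ 0 ∧ (s : FractionRing D) = algebraMap D _ a / algebraMap D _ b := by
  refine Subring.closure_induction (p := fun (s : recip D) _ => ∃ a b : D, a ∈ avoidingSubring P ∧
    b ∈ avoidingSubring P ∧ b ≠ 0 ∧ (s : FractionRing D) = algebraMap D _ a / algebraMap D _ b)
    ?_ ?_ ?_ ?_ ?_ ?_ hs
  · rintro _ ⟨d, hd, rfl⟩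
    refine ⟨1, d, one_mem _, fun _ => hd, ?_, by simp [coe_recipInv]⟩
    rintro rfl
    exact hd (by simp)
  · exact ⟨0, 1, zero_mem _, one_mem _, one_ne_zero, by simp⟩
  · exact ⟨1, 1, one_mem _, one_mem _, one_ne_zero, by simp⟩
  · rintro x y - - ⟨a, b, ha, hb, hb0, hx⟩ ⟨a', b', ha', hb', hb0', hy⟩
    refine ⟨a * b' + b * a', b * b', add_mem (mul_mem ha hb') (mul_mem hb ha'), mul_mem hb hb',
      mul_ne_zero hb0 hb0', ?_⟩
    rw [Subring.coe_add, hx, hy, div_add_div _ _ (by simpa using hb0) (by simpa using hb0')]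
    simp
  · rintro x - ⟨a, b, ha, hb, hb0, hx⟩
    exact ⟨-a, b, neg_mem ha, hb, hb0, by simp [hx, neg_div]⟩
  · rintro x y - - ⟨a, b, ha, hb, hb0, hx⟩ ⟨a', b', ha', hb', hb0', hy⟩
    refine ⟨a * a', b * b', mul_mem ha ha', mul_mem hb hb', mul_ne_zero hb0 hb0', ?_⟩
    rw [Subring.coe_mul, hx, hy, div_mul_div_comm]
    simp

theorem eq_zero_of_mem_avoidingRecip [hP : P.IsPrime] {s : recip D}
    (hs : s ∈ avoidingRecip P) (hsP : s ∈ P) : s = 0 := by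
  obtain ⟨a, b, ha, hb, hb0, h⟩ := exists_fraction_of_mem_avoidingRecip P hs
  obtain ha0 | ha0 := eq_or_ne a 0
  · ext
    simp [h, ha0]
  have key : recipInv a * s = recipInv b := by
    have ha' : algebraMap D (FractionRing D) a ≠ 0 := by simpa using ha0
    ext
    rw [Subring.coe_mul, h, coe_recipInv, coe_recipInv]
    field_simp
  exact absurd (key ▸ P.mul_mem_left (recipInv a) hsP) (hb hb0)

theorem exists_sub_mem_span_recipsIn (x : recip D) :
    ∃ s ∈ avoidingRecip P, x - s ∈ Ideal.span (recipsIn P) := by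
  induction x using recip_induction with
  | inv d =>
    by_cases hd : recipInv d ∈ P
    · refine ⟨0, zero_mem _, ?_⟩
      rw [sub_zero]
      by_cases hd0 : d = 0
      · simp [hd0]
      · exact Ideal.subset_span ⟨hd, d, hd0, rfl⟩
    · exact ⟨_, Subring.subset_closure ⟨d, hd, rfl⟩, by simp⟩
  | add x y hx hy =>
    obtain ⟨s, hs, hxs⟩ := hx
    obtain ⟨t, ht, hyt⟩ := hy
    refine ⟨s + t, add_mem hs ht, ?_⟩
    rw [add_sub_add_comm]
    exact add_mem hxs hyt
  | neg x hx =>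
    obtain ⟨s, hs, hxs⟩ := hx
    refine ⟨-s, neg_mem hs, ?_⟩
    rw [← neg_sub']
    exact neg_mem hxs
  | mul x y hx hy =>
    obtain ⟨s, hs, hxs⟩ := hx
    obtain ⟨t, ht, hyt⟩ := hy
    refine ⟨s * t, mul_mem hs ht, ?_⟩
    rw [show x * y - s * t = y * (x - s) + s * (y - t) by ring]
    exact add_mem (Ideal.mul_mem_left _ _ hxs) (Ideal.mul_mem_left _ _ hyt)

theorem span_recipsIn [P.IsPrime] : Ideal.span (recipsIn P) = P := by
  have hle : Ideal.span (recipsIn P) ≤ P := Ideal.span_le.2 fun _ hx => hx.1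
  refine le_antisymm hle fun x hx => ?_
  obtain ⟨s, hs, hxs⟩ := exists_sub_mem_span_recipsIn P x
  have hsP : s ∈ P := by simpa using sub_mem hx (hle hxs)
  rwa [eq_zero_of_mem_avoidingRecip P hs hsP, sub_zero] at hxs

/-- If reciprocals generate a prime `M`, then every nonzero finitely generated prime below `M`
contains one of them. -/
theorem exists_generator_mem_of_le {M : Ideal (recip D)} (hM : M.IsPrime) {T : Set (recip D)}
    (hT : ∀ t ∈ T, ∃ d : D, t = recipInv d) (hTM : Ideal.span T = M) [hP : P.IsPrime]
    (hP0 : P ≠ ⊥) (hPfg : P.FG) (hPM : P ≤ M) : ∃ t ∈ T, t ∈ P := by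
  by_contra! hnot
  have hdecomp : ∀ x ∈ Ideal.span T, ∃ s ∈ avoidingRecip P, x - s ∈ M * P := by
    intro x hx
    induction hx using Submodule.span_induction with
    | mem t ht =>
      obtain ⟨d, rfl⟩ := hT t ht
      exact ⟨_, Subring.subset_closure ⟨d, hnot _ ht, rfl⟩, by simp⟩
    | zero => exact ⟨0, zero_mem _, by simp⟩
    | add x y _ _ hx hy =>
      obtain ⟨s, hs, hxs⟩ := hx
      obtain ⟨t, ht, hyt⟩ := hy
      refine ⟨s + t, add_mem hs ht, ?_⟩
      rw [add_sub_add_comm]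
      exact add_mem hxs hyt
    | smul r x hxT hx =>
      obtain ⟨s, hs, hxs⟩ := hx
      obtain ⟨t, ht, hrt⟩ := exists_sub_mem_span_recipsIn P r
      rw [span_recipsIn] at hrt
      refine ⟨t * s, mul_mem ht hs, ?_⟩
      rw [smul_eq_mul, show r * x - t * s = x * (r - t) + t * (x - s) by ring]
      exact add_mem (Ideal.mul_mem_mul (hTM.le hxT) hrt) (Ideal.mul_mem_left _ _ hxs)
  have hle : P ≤ M * P := fun x hx => by
    obtain ⟨s, hs, hxs⟩ := hdecomp x (hTM.ge (hPM hx))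
    have hsP : s ∈ P := by
      have hmul : M * P ≤ P := Ideal.mul_le_right
      have := P.sub_mem hx (hmul hxs)
      rwa [sub_sub_cancel] at this
    rwa [eq_zero_of_mem_avoidingRecip P hs hsP, sub_zero] at hxs
  exact hP0 (Ideal.eq_bot_of_fg_of_le_mul hM.ne_top hPfg hle)

theorem exists_mem_nonzero_primes_le [IsNoetherianRing (recip D)] (M : Ideal (recip D))
    [hM : M.IsPrime] : ∃ c : recip D, c ≠ 0 ∧
      ∀ P : Ideal (recip D), P.IsPrime → P ≠ ⊥ → P ≤ M → c ∈ P := by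
  obtain ⟨T, hT, hspan⟩ := (Submodule.fg_span_iff_fg_span_finset_subset (recipsIn M)).1
    (IsNoetherian.noetherian (Ideal.span (recipsIn M)))
  have hTM : Ideal.span (T : Set (recip D)) = M := hspan.symm.trans (span_recipsIn M)
  refine ⟨∏ t ∈ T, t, Finset.prod_ne_zero_iff.2 fun t ht => ?_, fun P hP hP0 hPM => ?_⟩
  · obtain ⟨-, d, hd, rfl⟩ := hT ht
    exact recipInv_ne_zero hd
  · obtain ⟨t, ht, htP⟩ := exists_generator_mem_of_le P hM
      (fun t ht => (hT ht).2.imp fun _ h => h.2) hTM hP0 (IsNoetherian.noetherian P) hPM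
    exact P.mem_of_dvd (Finset.dvd_prod_of_mem _ ht) htP

end Recip

/-- If `R(D)` is Noetherian, then its Krull dimension is at most 1. -/
theorem stmt_12 (D : Type*) [CommRing D] [IsDomain D]
    (h : IsNoetherianRing (recip D)) : ringKrullDim (recip D) ≤ 1 := by
  rw [ringKrullDim_le_iff_height_le]
  intro M hM
  obtain ⟨c, hc, hcP⟩ := exists_mem_nonzero_primes_le M
  exact_mod_cast height_le_one_of_mem_nonzero_primes_le M c hc hcP
end
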